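/- The converse of the main soundness theorem fails: there exist a labeled protocol Π and a formula φ of the labeled logic L2^l such that Π satisfies φ but the label-erased protocol |Π| does not satisfy the label-erased formula |φ|. Concretely, this is witnessed by the two-role protocol Π with Π(1) = (init, {⟨X^1_{A1}, ⟨{X^1_{A1}}_{ek(A3)}^{ag(1)}, {X^1_{A1}}_{ek(A3)}^{ag(2)}⟩⟩}_{ek(A2)}^{ag(3)}) and Π(2) = ({⟨X^1_{A1}, ⟨C^1_{A2}, C^2_{A2}⟩⟩}_{ek(A2)}^L, stop), and the formula φ2(tr) = ∀LS_{1,2}(tr) ς. ∀LS_{2,2}(tr) ς'. (NC(tr, ς(A1)) ∧ NC(tr, ς(A2)) ∧ (ς(X^1_{A1}) = ς'(X^1_{A1}))) → (ς'(C^1_{A2}) ≠ ς'(C^2_{A2})), which lies in L2^l since the only positive equality test is between nonce-variable instantiations and the final test is an inequality. -/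

import Mathlib

set_option linter.unusedVariables false

namespace Proto

/-- Labels: label variables, agent labels `ag i`, adversary labels `adv j`. -/
inductive Label where
  | lvar : ℕ → Label
  | ag : ℕ → Label
  | adv : ℕ → Label
deriving DecidableEq

/-- Sorted object-level variables: agent variables `A_i`, nonce variables
`X^j_{A_i}`, ciphertext variables and signature variables. -/
inductive Var where
  | agentV : ℕ → Var
  | nonceV : ℕ → ℕ → Var
  | cipherV : ℕ → Var
  | sigV : ℕ → Var
deriving DecidableEq

/-- Agent expressions occurring in key positions: identities or agent variables. -/
inductive AgentE where
  | const : ℕ → AgentE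
  | avar : ℕ → AgentE
deriving DecidableEq

/-- Terms.  Labeled terms `T^l` are all terms; unlabeled terms `T` are identified
with the label-free ones (all encryption/signature labels equal to `none`). -/
inductive Term where
  | var : Var → Term
  | agent : ℕ → Term
  | ek : AgentE → Term
  | dk : AgentE → Term
  | sk : AgentE → Term
  | vk : AgentE → Term
  | nonce : ℕ → ℕ → ℕ → Term          -- n(a, j, s)
  | pair : Term → Term → Term
  | enc : AgentE → Term → Option Label → Term   -- {m}_{ek(a)}^ℓ
  | sign : AgentE → Term → Option Label → Term  -- [m]_{sk(a)}^ℓ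
deriving DecidableEq

/-- The erasure map `|·|` : removes all labels and commutes with every other
constructor. -/
def erase : Term → Term
  | .var x => .var x
  | .agent a => .agent a
  | .ek a => .ek a
  | .dk a => .dk a
  | .sk a => .sk a
  | .vk a => .vk a
  | .nonce a j s => .nonce a j s
  | .pair t₁ t₂ => .pair (erase t₁) (erase t₂)
  | .enc a t _ => .enc a (erase t) none
  | .sign a t _ => .sign a (erase t) none

/-- Simple terms: agent variables, nonce variables, agent identities, nonces. -/
inductive Term.Simple : Term → Prop
  | agv (i : ℕ) : Term.Simple (.var (.agentV i))
  | nov (i j : ℕ) : Term.Simple (.var (.nonceV i j))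
  | agent (a : ℕ) : Term.Simple (.agent a)
  | nonce (a j s : ℕ) : Term.Simple (.nonce a j s)

/-- A term contains an encryption or a signature subterm. -/
inductive HasCrypt : Term → Prop
  | enc (a : AgentE) (t : Term) (l : Option Label) : HasCrypt (.enc a t l)
  | sign (a : AgentE) (t : Term) (l : Option Label) : HasCrypt (.sign a t l)
  | pairL {t₁ : Term} (t₂ : Term) : HasCrypt t₁ → HasCrypt (.pair t₁ t₂)
  | pairR (t₁ : Term) {t₂ : Term} : HasCrypt t₂ → HasCrypt (.pair t₁ t₂)

/-- The labeled Dolev-Yao deduction relation `S ⊢ˡ m`. -/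
inductive LDeduce : Set Term → Term → Prop
  | mem {S : Set Term} {m : Term} : m ∈ S → LDeduce S m
  | agentK (S : Set Term) (b : ℕ) : LDeduce S (.agent b)
  | ekK (S : Set Term) (b : ℕ) : LDeduce S (.ek (.const b))
  | vkK (S : Set Term) (b : ℕ) : LDeduce S (.vk (.const b))
  | pairI {S m₁ m₂} : LDeduce S m₁ → LDeduce S m₂ → LDeduce S (.pair m₁ m₂)
  | fstE {S m₁ m₂} : LDeduce S (.pair m₁ m₂) → LDeduce S m₁
  | sndE {S m₁ m₂} : LDeduce S (.pair m₁ m₂) → LDeduce S m₂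
  | encI {S b m} (i : ℕ) : LDeduce S (.ek b) → LDeduce S m →
      LDeduce S (.enc b m (some (.adv i)))
  | decI {S b m l} : LDeduce S (.enc b m l) → LDeduce S (.dk b) → LDeduce S m
  | signI {S b m} (i : ℕ) : LDeduce S (.sk b) → LDeduce S m →
      LDeduce S (.sign b m (some (.adv i)))
  | signE {S b m l} : LDeduce S (.sign b m l) → LDeduce S m

/-- The unlabeled Dolev-Yao deduction relation `S ⊢ m` (same rules, labels removed). -/
inductive UDeduce : Set Term → Term → Prop
  | mem {S : Set Term} {m : Term} : m ∈ S → UDeduce S m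
  | agentK (S : Set Term) (b : ℕ) : UDeduce S (.agent b)
  | ekK (S : Set Term) (b : ℕ) : UDeduce S (.ek (.const b))
  | vkK (S : Set Term) (b : ℕ) : UDeduce S (.vk (.const b))
  | pairI {S m₁ m₂} : UDeduce S m₁ → UDeduce S m₂ → UDeduce S (.pair m₁ m₂)
  | fstE {S m₁ m₂} : UDeduce S (.pair m₁ m₂) → UDeduce S m₁
  | sndE {S m₁ m₂} : UDeduce S (.pair m₁ m₂) → UDeduce S m₂
  | encI {S b m} : UDeduce S (.ek b) → UDeduce S m → UDeduce S (.enc b m none)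
  | decI {S b m l} : UDeduce S (.enc b m l) → UDeduce S (.dk b) → UDeduce S m
  | signI {S b m} : UDeduce S (.sk b) → UDeduce S m → UDeduce S (.sign b m none)
  | signE {S b m l} : UDeduce S (.sign b m l) → UDeduce S m

/-- Sort-respecting (partial) substitutions: agent variables go to identities,
nonce variables to nonces `n(a,j,s)`, ciphertext/signature variables to terms,
label variables to labels. -/
structure Subst where
  agv : ℕ → Option ℕ
  nov : ℕ → ℕ → Option (ℕ × ℕ × ℕ)
  civ : ℕ → Option Term
  siv : ℕ → Option Term
  lbv : ℕ → Option Label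

def Subst.applyA (σ : Subst) : AgentE → AgentE
  | .const a => .const a
  | .avar i =>
    match σ.agv i with
    | some a => .const a
    | none => .avar i

def Subst.applyLb (σ : Subst) : Option Label → Option Label
  | some (.lvar n) =>
    match σ.lbv n with
    | some l => some l
    | none => some (.lvar n)
  | l => l

/-- Homomorphic application of a substitution to a term. -/
def Subst.apply (σ : Subst) : Term → Term
  | .var (.agentV i) =>
    match σ.agv i with
    | some a => .agent a
    | none => .var (.agentV i)
  | .var (.nonceV i j) =>
    match σ.nov i j with
    | some (a, j', s) => .nonce a j' s
    | none => .var (.nonceV i j)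
  | .var (.cipherV i) => (σ.civ i).getD (.var (.cipherV i))
  | .var (.sigV i) => (σ.siv i).getD (.var (.sigV i))
  | .agent a => .agent a
  | .ek a => .ek (σ.applyA a)
  | .dk a => .dk (σ.applyA a)
  | .sk a => .sk (σ.applyA a)
  | .vk a => .vk (σ.applyA a)
  | .nonce a j s => .nonce a j s
  | .pair t₁ t₂ => .pair (σ.apply t₁) (σ.apply t₂)
  | .enc a t l => .enc (σ.applyA a) (σ.apply t) (σ.applyLb l)
  | .sign a t l => .sign (σ.applyA a) (σ.apply t) (σ.applyLb l)

/-- The erased substitution `|σ|`, with `|σ|(X) = |σ(X)|` (label variables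
disappear under erasure). -/
def eraseSubst (σ : Subst) : Subst :=
  { agv := σ.agv
    nov := σ.nov
    civ := fun i => (σ.civ i).map erase
    siv := fun i => (σ.siv i).map erase
    lbv := fun _ => none }

def Subst.union (σ θ : Subst) : Subst :=
  { agv := fun i => (σ.agv i).orElse fun _ => θ.agv i
    nov := fun i j => (σ.nov i j).orElse fun _ => θ.nov i j
    civ := fun i => (σ.civ i).orElse fun _ => θ.civ i
    siv := fun i => (σ.siv i).orElse fun _ => θ.siv i
    lbv := fun i => (σ.lbv i).orElse fun _ => θ.lbv i }

def Subst.empty : Subst :=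
  ⟨fun _ => none, fun _ _ => none, fun _ => none, fun _ => none, fun _ => none⟩

/-! ## The execution model -/

/-- Session identifiers `(n, j, (a_1, ..., a_k))`. -/
abbrev SessionId := ℕ × ℕ × List ℕ

/-- Local states `(σ, i, p)`. -/
abbrev LState := Subst × ℕ × ℕ

/-- Global states `(SId, f, H)` (the corrupted agents of the initial corrupt
action, if any, are recorded in the state). -/
structure GState where
  sids : List SessionId
  f : SessionId → Option LState
  H : Set Term
  corrupted : List ℕ

/-- A protocol maps each role index to a sequence of
(expected pattern, response) pairs; `none` stands for `init` / `stop`. -/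
abbrev Protocol := ℕ → List (Option Term × Option Term)

/-- Symbolic execution traces (most recent global state first). -/
abbrev Trace := List GState

/-- The knowledge of an agent: its secret keys and its nonces. -/
def kn (a : ℕ) : Set Term :=
  {t | t = .dk (.const a) ∨ t = .sk (.const a) ∨ ∃ j s, t = .nonce a j s}

def initG : GState := ⟨[], fun _ => none, ∅, []⟩

def corruptG (as : List ℕ) : GState :=
  { initG with H := {t | ∃ a ∈ as, t ∈ kn a}, corrupted := as }

/-- The initial partial substitution of a new session of role `i` with agents
`as` and session number `s`: agent variables are instantiated to the agents,
and the nonce variables of role `i` to fresh nonces `n(a_i, j, s)`. -/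
def initSubst (i : ℕ) (as : List ℕ) (s : ℕ) : Subst :=
  { agv := fun j => as[j-1]?
    nov := fun i' j => if i' = i then (as[i-1]?).map (fun a => (a, j, s)) else none
    civ := fun _ => none
    siv := fun _ => none
    lbv := fun _ => none }

def newG (g : GState) (i : ℕ) (as : List ℕ) : GState :=
  let s := g.sids.length + 1
  { g with
    sids := (s, i, as) :: g.sids
    f := Function.update g.f (s, i, as) (some (initSubst i as s, i, 1)) }

/-- `MatchPat σ θ lp m`: the message `m` matches the (optional) pattern `lp`
instantiated by `σ`, via the substitution `θ`. -/
def MatchPat (σ θ : Subst) (lp : Option Term) (m : Term) : Prop :=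
  match lp with
  | some l => m = θ.apply (σ.apply l)
  | none => θ = Subst.empty

def sendG (g : GState) (sid : SessionId) (σ : Subst) (j p : ℕ)
    (rr : Option Term) (θ : Subst) : GState :=
  { g with
    f := Function.update g.f sid (some (σ.union θ, j, p+1))
    H := match rr with
         | some r => insert (θ.apply (σ.apply r)) g.H
         | none => g.H }

def CanMatch (P : Protocol) (g : GState) (sid : SessionId) (m : Term) : Prop :=
  ∃ σ j p lp rr θ,
    g.f sid = some (σ, j, p) ∧ (P j)[p-1]? = some (lp, rr) ∧ MatchPat σ θ lp m

/-- The effect of a `send(sid, m)` transition: either the message matches the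
expected pattern and the session advances, or the state is left unchanged. -/
inductive SendStep (P : Protocol) (g : GState) (sid : SessionId) (m : Term) :
    GState → Prop
  | succ {σ : Subst} {j p : ℕ} {lp rr : Option Term} {θ : Subst} :
      g.f sid = some (σ, j, p) → (P j)[p-1]? = some (lp, rr) →
      MatchPat σ θ lp m → SendStep P g sid m (sendG g sid σ j p rr θ)
  | fail : ¬ CanMatch P g sid m → SendStep P g sid m g

/-- Valid execution traces of protocol `P` with respect to a deduction relation
`D` : every adversary-sent message must be deducible (by `D`) from the current
knowledge, and a corrupt action may occur only as first transition. -/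
inductive ExecD (D : Set Term → Term → Prop) (P : Protocol) : Trace → Prop
  | start : ExecD D P [initG]
  | corrupt (as : List ℕ) : ExecD D P [corruptG as, initG]
  | new {tr : Trace} {g : GState} (i : ℕ) (as : List ℕ) :
      ExecD D P (g :: tr) → ExecD D P (newG g i as :: g :: tr)
  | send {tr : Trace} {g g' : GState} (sid : SessionId) (m : Term) :
      ExecD D P (g :: tr) → D g.H m → SendStep P g sid m g' →
      ExecD D P (g' :: g :: tr)

/-- `tr ∈ Exec(Π)` for the labeled model. -/
def LExec (P : Protocol) : Trace → Prop := ExecD LDeduce P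

/-- `tr ∈ Exec(Π)` for the unlabeled model. -/
def UExec (P : Protocol) : Trace → Prop := ExecD UDeduce P

/-- Erasure of global states. -/
def eraseState (g : GState) : GState :=
  { sids := g.sids
    f := fun s => (g.f s).map fun x => (eraseSubst x.1, x.2.1, x.2.2)
    H := erase '' g.H
    corrupted := g.corrupted }

/-- Erasure of traces. -/
def eraseTrace : Trace → Trace := List.map eraseState

/-- Erasure of protocols. -/
def eraseProt (P : Protocol) : Protocol :=
  fun i => (P i).map fun x => (x.1.map erase, x.2.map erase)

/-! ## The security logic -/

/-- Agent expressions of the extended term algebra `T_Sub`: identities or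
meta-substitution variables applied to agent variables. -/
inductive SAgentE where
  | const : ℕ → SAgentE
  | svar : ℕ → ℕ → SAgentE        -- ς_k(A_i)
deriving DecidableEq

inductive SLabel where
  | ag : ℕ → SLabel
  | adv : ℕ → SLabel
  | svar : ℕ → ℕ → SLabel         -- ς_k(x_l)
deriving DecidableEq

/-- Terms of the extended algebra `T_Sub^l`, with applications `ς_k(x)` of
meta-variables for substitutions to object variables. -/
inductive STerm where
  | svar : ℕ → Var → STerm        -- ς_k(x)
  | agent : ℕ → STerm
  | ek : SAgentE → STerm
  | dk : SAgentE → STerm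
  | sk : SAgentE → STerm
  | vk : SAgentE → STerm
  | nonce : ℕ → ℕ → ℕ → STerm
  | pair : STerm → STerm → STerm
  | enc : SAgentE → STerm → Option SLabel → STerm
  | sign : SAgentE → STerm → Option SLabel → STerm
deriving DecidableEq

def evalA (η : ℕ → Subst) : SAgentE → AgentE
  | .const a => .const a
  | .svar k i =>
    match (η k).agv i with
    | some a => .const a
    | none => .avar i

def evalLb (η : ℕ → Subst) : Option SLabel → Option Label
  | none => none
  | some (.ag i) => some (.ag i)
  | some (.adv i) => some (.adv i)
  | some (.svar k n) =>
    match (η k).lbv n with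
    | some l => some l
    | none => some (.lvar n)

/-- Interpretation of an extended term under an assignment `η` of the
meta-variables for substitutions. -/
def evalT (η : ℕ → Subst) : STerm → Term
  | .svar k x => (η k).apply (.var x)
  | .agent a => .agent a
  | .ek a => .ek (evalA η a)
  | .dk a => .dk (evalA η a)
  | .sk a => .sk (evalA η a)
  | .vk a => .vk (evalA η a)
  | .nonce a j s => .nonce a j s
  | .pair t₁ t₂ => .pair (evalT η t₁) (evalT η t₂)
  | .enc a t l => .enc (evalA η a) (evalT η t) (evalLb η l)
  | .sign a t l => .sign (evalA η a) (evalT η t) (evalLb η l)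

/-- Erasure on extended terms (`|ς(x)| = ς(x)`). -/
def eraseST : STerm → STerm
  | .svar k x => .svar k x
  | .agent a => .agent a
  | .ek a => .ek a
  | .dk a => .dk a
  | .sk a => .sk a
  | .vk a => .vk a
  | .nonce a j s => .nonce a j s
  | .pair t₁ t₂ => .pair (eraseST t₁) (eraseST t₂)
  | .enc a t _ => .enc a (eraseST t) none
  | .sign a t _ => .sign a (eraseST t) none

/-- Erasure of assignments of the substitution meta-variables. -/
def eraseEnv (η : ℕ → Subst) : ℕ → Subst := fun k => eraseSubst (η k)

/-- Formulas of the logic `L1` (labeled: `L1^l`; the unlabeled logic `L1` is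
obtained over erased terms).  `fa i p k F` is `∀LS_{i,p}(tr) ς_k. F` and
`ex i p k F` is `∃LS_{i,p}(tr) ς_k. F`. -/
inductive Formula where
  | nc : STerm → Formula
  | eq : STerm → STerm → Formula
  | not : Formula → Formula
  | and : Formula → Formula → Formula
  | or : Formula → Formula → Formula
  | fa : ℕ → ℕ → ℕ → Formula → Formula
  | ex : ℕ → ℕ → ℕ → Formula → Formula

/-- Erasure of formulas. -/
def eraseF : Formula → Formula
  | .nc t => .nc (eraseST t)
  | .eq t₁ t₂ => .eq (eraseST t₁) (eraseST t₂)
  | .not F => .not (eraseF F)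
  | .and F₁ F₂ => .and (eraseF F₁) (eraseF F₂)
  | .or F₁ F₂ => .or (eraseF F₁) (eraseF F₂)
  | .fa i p k F => .fa i p k (eraseF F)
  | .ex i p k F => .ex i p k (eraseF F)

/-- The local states `LS_{i,p}(tr)` for role `i` at control point `p`
occurring in the trace `tr` (their substitution components). -/
def LS (i p : ℕ) (tr : Trace) : Set Subst :=
  {σ | ∃ g ∈ tr, ∃ s, g.f s = some (σ, i, p)}

/-- Interpretation of `NC(tr, t)`: `t` denotes an agent identity that does not
appear in the (initial) corrupt action of `tr`. -/
def NCsem (tr : Trace) (η : ℕ → Subst) (t : STerm) : Prop :=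
  ∃ a, evalT η t = .agent a ∧ ∀ g ∈ tr, a ∉ g.corrupted

/-- Semantics `⟦F(tr)⟧ = 1` of formulas (under an assignment `η` of the
substitution meta-variables; equality is syntactic). -/
def Sem (tr : Trace) : Formula → (ℕ → Subst) → Prop
  | .nc t, η => NCsem tr η t
  | .eq t₁ t₂, η => evalT η t₁ = evalT η t₂
  | .not F, η => ¬ Sem tr F η
  | .and F₁ F₂, η => Sem tr F₁ η ∧ Sem tr F₂ η
  | .or F₁ F₂, η => Sem tr F₁ η ∨ Sem tr F₂ η
  | .fa i p k F, η => ∀ θ ∈ LS i p tr, Sem tr F (Function.update η k θ)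
  | .ex i p k F, η => ∃ θ ∈ LS i p tr, Sem tr F (Function.update η k θ)

/-- `Π ⊨ φ` in the labeled model. -/
def LSat (P : Protocol) (φ : Formula) : Prop :=
  ∀ tr, LExec P tr → ∀ η, Sem tr φ η

/-- `Π ⊨ φ` in the unlabeled model. -/
def USat (P : Protocol) (φ : Formula) : Prop :=
  ∀ tr, UExec P tr → ∀ η, Sem tr φ η

/-- Simple extended terms: meta-variables applied to agent or nonce variables,
agent identities, and nonces. -/
inductive STerm.Simple : STerm → Prop
  | agv (k i : ℕ) : STerm.Simple (.svar k (.agentV i))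
  | nov (k i j : ℕ) : STerm.Simple (.svar k (.nonceV i j))
  | agent (a : ℕ) : STerm.Simple (.agent a)
  | nonce (a j s : ℕ) : STerm.Simple (.nonce a j s)

/-- The fragment `L2` (`L2^l`): no arbitrary negation, inequality tests between
arbitrary terms, equality tests between simple terms only. -/
inductive IsL2 : Formula → Prop
  | nc (t : STerm) : IsL2 (.nc t)
  | nnc (t : STerm) : IsL2 (.not (.nc t))
  | and {F₁ F₂ : Formula} : IsL2 F₁ → IsL2 F₂ → IsL2 (.and F₁ F₂)
  | or {F₁ F₂ : Formula} : IsL2 F₁ → IsL2 F₂ → IsL2 (.or F₁ F₂)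
  | neq (t₁ t₂ : STerm) : IsL2 (.not (.eq t₁ t₂))
  | eq {u₁ u₂ : STerm} : u₁.Simple → u₂.Simple → IsL2 (.eq u₁ u₂)
  | fa (i p k : ℕ) {F : Formula} : IsL2 F → IsL2 (.fa i p k F)
  | ex (i p k : ℕ) {F : Formula} : IsL2 F → IsL2 (.ex i p k F)

end Proto

namespace Proto

/-- The nonce variable `X^1_{A_1}`. -/
def nX : Term := .var (.nonceV 1 1)

/-- `Π(1)`'s response:
`{⟨X^1_{A1}, ⟨{X^1_{A1}}_{ek(A3)}^{ag(1)}, {X^1_{A1}}_{ek(A3)}^{ag(2)}⟩⟩}_{ek(A2)}^{ag(3)}`. -/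
def respA : Term :=
  .enc (.avar 2)
    (.pair nX (.pair (.enc (.avar 3) nX (some (.ag 1)))
                     (.enc (.avar 3) nX (some (.ag 2)))))
    (some (.ag 3))

/-- `Π(2)`'s expected pattern:
`{⟨X^1_{A1}, ⟨C^1_{A2}, C^2_{A2}⟩⟩}_{ek(A2)}^L`. -/
def pattB : Term :=
  .enc (.avar 2) (.pair nX (.pair (.var (.cipherV 1)) (.var (.cipherV 2))))
    (some (.lvar 0))

/-- The two-role counterexample protocol:
`Π(1) = (init, respA)` and `Π(2) = (pattB, stop)`. -/
def exProt : Protocol := fun i =>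
  if i = 1 then [(none, some respA)]
  else if i = 2 then [(some pattB, none)]
  else []

end Proto

namespace Proto

/-- The `L2^l` formula
`φ2(tr) = ∀LS_{1,2}(tr) ς. ∀LS_{2,2}(tr) ς'.
  (NC(tr, ς(A1)) ∧ NC(tr, ς(A2)) ∧ (ς(X^1_{A1}) = ς'(X^1_{A1})))
    → (ς'(C^1_{A2}) ≠ ς'(C^2_{A2}))`,
written in the negation-normal form required by the `L2^l` grammar
(`¬NC ∨ ¬NC ∨ (ς(X^1_{A1}) ≠ ς'(X^1_{A1})) ∨ (ς'(C^1_{A2}) ≠ ς'(C^2_{A2}))`). -/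
def phi2 : Formula :=
  .fa 1 2 0 (.fa 2 2 1
    (.or
      (.or (.or (.not (.nc (.svar 0 (.agentV 1))))
                (.not (.nc (.svar 0 (.agentV 2)))))
           (.not (.eq (.svar 0 (.nonceV 1 1)) (.svar 1 (.nonceV 1 1)))))
      (.not (.eq (.svar 1 (.cipherV 1)) (.svar 1 (.cipherV 2))))))

theorem empty_applyA (a : AgentE) : Subst.empty.applyA a = a := by
  cases a <;> rfl

theorem empty_applyLb (l : Option Label) : Subst.empty.applyLb l = l := by
  rcases l with _ | l
  · rfl
  · cases l <;> rfl

theorem empty_apply (t : Term) : Subst.empty.apply t = t := by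
  induction t with
  | var x => cases x <;> rfl
  | pair a b h1 h2 => simp [Subst.apply, h1, h2]
  | enc a t l h => simp [Subst.apply, h, empty_applyA, empty_applyLb]
  | sign a t l h => simp [Subst.apply, h, empty_applyA, empty_applyLb]
  | _ => simp [Subst.apply, empty_applyA]

theorem LDeduce.mono {S T : Set Term} {m : Term} (h : LDeduce S m) (hST : S ⊆ T) :
    LDeduce T m := by
  induction h with
  | mem h => exact .mem (hST h)
  | agentK b => exact .agentK _ _
  | ekK b => exact .ekK _ _
  | vkK b => exact .vkK _ _
  | pairI _ _ h1 h2 => exact .pairI h1 h2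
  | fstE _ h => exact .fstE h
  | sndE _ h => exact .sndE h
  | encI i _ _ h1 h2 => exact .encI i h1 h2
  | decI _ _ h1 h2 => exact .decI h1 h2
  | signI i _ _ h1 h2 => exact .signI i h1 h2
  | signE _ h => exact .signE h

/-- An over-approximation of what the adversary can derive. -/
def Safe (cor : List ℕ) (N M : Term) : Term → Prop
  | .dk a => ∃ c ∈ cor, a = .const c
  | .nonce a j s => Term.nonce a j s ≠ N
  | .pair a b => Safe cor N M a ∧ Safe cor N M b
  | .enc a t l => Safe cor N M t ∨ Term.enc a t l = M
  | .sign _ t _ => Safe cor N M t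
  | _ => True

theorem safe_of_deduce {cor : List ℕ} {N M : Term} {S : Set Term}
    (hM : ∀ c ∈ cor, ∀ t l, Term.enc (.const c) t l ≠ M)
    (hS : ∀ t ∈ S, Safe cor N M t) {m : Term} (h : LDeduce S m) : Safe cor N M m := by
  induction h with
  | mem h => exact hS _ h
  | agentK b => trivial
  | ekK b => trivial
  | vkK b => trivial
  | pairI _ _ h1 h2 => exact ⟨h1, h2⟩
  | fstE _ h => exact h.1
  | sndE _ h => exact h.2
  | encI i _ _ h1 h2 => exact Or.inl h2
  | decI _ _ h1 h2 =>
    obtain ⟨c, hc, rfl⟩ := h2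
    rcases h1 with h | h
    · exact h
    · exact absurd h (hM c hc _ _)
  | signI i _ _ h1 h2 => exact h2
  | signE _ h => exact h

/-- What is known about a local state. -/
def Loc (H : Set Term) (s i : ℕ) (as : List ℕ) (σ : Subst) (p : ℕ) : Prop :=
  (p = 1 ∧ σ = initSubst i as s) ∨
  (p = 2 ∧ i = 1 ∧ σ = (initSubst 1 as s).union Subst.empty) ∨
  (p = 2 ∧ i = 2 ∧ ∃ b l, LDeduce H (.enc b (.pair (σ.apply nX)
    (.pair (σ.apply (.var (.cipherV 1))) (σ.apply (.var (.cipherV 2))))) l))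

structure Inv (g : GState) (tr : Trace) : Prop where
  know : ∀ t ∈ g.H, (∃ a ∈ g.corrupted, t ∈ kn a) ∨
    ∃ as s, (s, 1, as) ∈ g.sids ∧ t = (initSubst 1 as s).apply respA
  bound : ∀ x ∈ g.sids, x.1 ≤ g.sids.length
  uniq : ∀ x ∈ g.sids, ∀ y ∈ g.sids, x.1 = y.1 → x = y
  loc : ∀ g' ∈ g :: tr, ∀ s i as σ j p, g'.f (s, i, as) = some (σ, j, p) →
    (s, i, as) ∈ g.sids ∧ j = i ∧ Loc g.H s i as σ p

theorem Loc.mono {H H' : Set Term} (hH : H ⊆ H') {s i as σ p} (h : Loc H s i as σ p) :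
    Loc H' s i as σ p := by
  rcases h with h | h | ⟨h1, h2, b, l, h⟩
  · exact Or.inl h
  · exact Or.inr (Or.inl h)
  · exact Or.inr (Or.inr ⟨h1, h2, b, l, h.mono hH⟩)

theorem inv_of_exec {tr : Trace} (h : LExec exProt tr) :
    ∃ g tl, tr = g :: tl ∧ Inv g tl := by
  unfold LExec at h
  induction h with
  | start =>
    refine ⟨_, _, rfl, ?_, ?_, ?_, ?_⟩ <;> simp [initG]
  | corrupt as =>
    refine ⟨_, _, rfl, ?_, ?_, ?_, ?_⟩ <;> simp [initG, corruptG]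
  | @new tr g i as h ih =>
    obtain ⟨g0, tl, he, I⟩ := ih
    obtain ⟨rfl, rfl⟩ := List.cons.inj he
    refine ⟨_, _, rfl, ?_, ?_, ?_, ?_⟩
    · intro t ht
      rcases I.know t ht with h | ⟨as', s, h1, h2⟩
      · exact Or.inl h
      · exact Or.inr ⟨as', s, List.mem_cons_of_mem _ h1, h2⟩
    · intro x hx
      simp only [newG, List.length_cons] at hx ⊢
      rcases List.mem_cons.1 hx with rfl | hx
      · simp
      · have := I.bound x hx
        omega
    · intro x hx y hy hxy
      simp only [newG] at hx hy
      rcases List.mem_cons.1 hx with rfl | hx <;> rcases List.mem_cons.1 hy with rfl | hy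
      · rfl
      · have := I.bound y hy
        simp at hxy
        omega
      · have := I.bound x hx
        simp at hxy
        omega
      · exact I.uniq x hx y hy hxy
    · intro g' hg' s i' as' σ j p hf
      have key : ∀ g' ∈ g :: tr, g'.f (s, i', as') = some (σ, j, p) →
          (s, i', as') ∈ (newG g i as).sids ∧ j = i' ∧ Loc (newG g i as).H s i' as' σ p := by
        intro g' hg' hf
        obtain ⟨h1, h2, h3⟩ := I.loc g' hg' _ _ _ _ _ _ hf
        exact ⟨List.mem_cons_of_mem _ h1, h2, h3⟩
      rcases List.mem_cons.1 hg' with rfl | hg'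
      · by_cases hs : (s, i', as') = (g.sids.length + 1, i, as)
        · simp only [newG, hs, Function.update_self] at hf
          obtain ⟨rfl, rfl, rfl⟩ : s = _ ∧ i' = _ ∧ as' = _ := by simpa using hs
          obtain ⟨rfl, rfl, rfl⟩ : _ = σ ∧ _ = j ∧ _ = p := by simpa using hf
          exact ⟨List.mem_cons_self, rfl, Or.inl ⟨rfl, rfl⟩⟩
        · simp only [newG, Function.update_of_ne hs] at hf
          exact key g List.mem_cons_self hf
      · exact key g' hg' hf
  | @send tr g g' sid m h hD hstep ih =>
    obtain ⟨g0, tl, he, I⟩ := ih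
    obtain ⟨rfl, rfl⟩ := List.cons.inj he
    cases hstep with
    | fail _ =>
      refine ⟨_, _, rfl, I.know, I.bound, I.uniq, ?_⟩
      intro g' hg' 
      rcases List.mem_cons.1 hg' with rfl | hg'
      · exact I.loc _ List.mem_cons_self
      · exact I.loc _ hg'
    | @succ σ j p lp rr θ hf hP hm =>
      obtain ⟨s, i, as⟩ := sid
      obtain ⟨hs, rfl, hloc⟩ := I.loc g List.mem_cons_self _ _ _ _ _ _ hf
      have hp : p = 1 ∧ σ = initSubst j as s := by
        rcases hloc with h | ⟨rfl, rfl, _⟩ | ⟨rfl, rfl, _⟩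
        · exact h
        · simp [exProt] at hP
        · simp [exProt] at hP
      obtain ⟨rfl, rfl⟩ := hp
      have main : (∀ t ∈ (sendG g (s, j, as) (initSubst j as s) j 1 rr θ).H,
          t ∈ g.H ∨ (j = 1 ∧ t = (initSubst 1 as s).apply respA)) ∧
          Loc g.H s j as ((initSubst j as s).union θ) 2 := by
        by_cases h1 : j = 1
        · subst h1
          obtain ⟨rfl, rfl⟩ : none = lp ∧ some respA = rr := by simpa [exProt] using hP
          have : θ = Subst.empty := hm
          subst this
          refine ⟨?_, Or.inr (Or.inl ⟨rfl, rfl, rfl⟩)⟩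
          intro t ht
          rcases ht with ht | ht
          · exact Or.inr ⟨rfl, by rw [ht, empty_apply]⟩
          · exact Or.inl ht
        · by_cases h2 : j = 2
          · subst h2
            obtain ⟨rfl, rfl⟩ : some pattB = lp ∧ none = rr := by simpa [exProt] using hP
            refine ⟨fun t ht => Or.inl ht, Or.inr (Or.inr ⟨rfl, rfl, ?_⟩)⟩
            have hm' : m = θ.apply ((initSubst 2 as s).apply pattB) := hm
            subst hm'
            refine ⟨θ.applyA ((initSubst 2 as s).applyA (.avar 2)),
              θ.applyLb ((initSubst 2 as s).applyLb (some (.lvar 0))), ?_⟩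
            simpa [pattB, nX, Subst.apply, initSubst, Subst.union] using hD
          · simp [exProt, h1, h2] at hP
      obtain ⟨hH, hL⟩ := main
      have hsub : g.H ⊆ (sendG g (s, j, as) (initSubst j as s) j 1 rr θ).H := by
        intro t ht
        cases rr with
        | none => exact ht
        | some r => exact Or.inr ht
      refine ⟨_, _, rfl, ?_, I.bound, I.uniq, ?_⟩
      · intro t ht
        rcases hH t ht with h | ⟨rfl, h⟩
        · exact I.know t h
        · exact Or.inr ⟨as, s, hs, h⟩
      · intro g' hg' s' i' as' σ' j' p' hf'
        have key : ∀ g' ∈ g :: tr, g'.f (s', i', as') = some (σ', j', p') → _ :=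
          fun g' hg' hf' => I.loc g' hg' _ _ _ _ _ _ hf'
        rcases List.mem_cons.1 hg' with rfl | hg'
        · by_cases he : (s', i', as') = (s, j, as)
          · simp only [sendG, he, Function.update_self] at hf'
            obtain ⟨rfl, rfl, rfl⟩ : s' = _ ∧ i' = _ ∧ as' = _ := by simpa using he
            obtain ⟨rfl, rfl, rfl⟩ : _ = σ' ∧ _ = j' ∧ _ = p' := by simpa using hf'
            exact ⟨hs, rfl, hL.mono hsub⟩
          · simp only [sendG, Function.update_of_ne he] at hf'
            obtain ⟨h1, h2, h3⟩ := key g List.mem_cons_self hf'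
            exact ⟨h1, h2, h3.mono hsub⟩
        · obtain ⟨h1, h2, h3⟩ := key g' hg' hf'
          exact ⟨h1, h2, h3.mono hsub⟩

theorem lsat_phi2 : LSat exProt phi2 := by
  intro tr htr η
  obtain ⟨g, tl, rfl, I⟩ := inv_of_exec htr
  simp only [phi2, Sem]
  rintro σ ⟨g1, hg1, ⟨s, i, as⟩, hf1⟩ σ' ⟨g2, hg2, ⟨s', i', as'⟩, hf2⟩
  by_contra hcon
  simp only [not_or, not_not] at hcon
  obtain ⟨⟨⟨hA1, hA2⟩, hX⟩, hC⟩ := hcon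
  obtain ⟨a, ha, hac⟩ := hA1
  obtain ⟨b, hb, hbc⟩ := hA2
  have hac := hac g List.mem_cons_self
  have hbc := hbc g List.mem_cons_self
  simp [evalT] at ha hb hX hC
  obtain ⟨hs1, rfl, hl1⟩ := I.loc g1 hg1 _ _ _ _ _ _ hf1
  obtain ⟨hs2, rfl, hl2⟩ := I.loc g2 hg2 _ _ _ _ _ _ hf2
  rcases hl1 with ⟨h, _⟩ | ⟨_, _, rfl⟩ | ⟨_, h, _⟩
  · omega
  swap
  · omega
  rcases hl2 with ⟨h, _⟩ | ⟨_, h, _⟩ | ⟨_, _, B, L, hD⟩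
  · omega
  · omega
  have ha' : as[0]? = some a := by
    cases h : as[0]? <;> simp [Subst.apply, Subst.union, initSubst, Subst.empty, h] at ha
    simp [ha]
  have hb' : as[1]? = some b := by
    cases h : as[1]? <;> simp [Subst.apply, Subst.union, initSubst, Subst.empty, h] at hb
    simp [hb]
  have hN : σ'.apply nX = .nonce a 1 s := by
    rw [nX, ← hX]
    simp [Subst.apply, Subst.union, initSubst, ha']
  have hsafe : Safe g.corrupted (.nonce a 1 s) ((initSubst 1 as s).apply respA)
      (Term.enc B ((σ'.apply nX).pair ((σ'.apply (Term.var (Var.cipherV 1))).pair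
        (σ'.apply (Term.var (Var.cipherV 2))))) L) := by
    refine safe_of_deduce ?_ ?_ hD
    · intro c hc t l h
      simp [respA, Subst.apply, Subst.applyA, initSubst, hb'] at h
      exact hbc (h.1 ▸ hc)
    · intro t ht
      rcases I.know t ht with ⟨c, hc, rfl | rfl | ⟨j, s2, rfl⟩⟩ | ⟨as2, s2, hs, rfl⟩
      · exact ⟨c, hc, rfl⟩
      · trivial
      · intro h
        simp at h
        exact hac (h.1 ▸ hc)
      · by_cases he : s2 = s
        · have := I.uniq _ hs _ hs1 he
          obtain ⟨rfl, rfl⟩ : s2 = s ∧ as2 = as := by simpa using this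
          exact Or.inr rfl
        · left
          cases h : as2[0]? <;>
            simp [Safe, nX, Subst.apply, initSubst, h, he]
  rw [hN, hC] at hsafe
  rcases hsafe with h | h
  · exact h.1 rfl
  · simp [respA, Subst.apply, Subst.applyLb] at h
    have h1 := h.2.1.2.1
    have h2 := h.2.1.2.2
    rw [h1] at h2
    simp at h2

theorem l2_phi2 : IsL2 phi2 :=
  .fa _ _ _ (.fa _ _ _ (.or (.or (.or (.nnc _) (.nnc _)) (.neq _ _)) (.neq _ _)))

/-- The substitution used by the responder in the attack. -/
def thB : Subst :=
  { agv := fun _ => none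
    nov := fun _ _ => some (1, 1, 1)
    civ := fun _ => some (.enc (.const 3) (.nonce 1 1 1) none)
    siv := fun _ => none
    lbv := fun _ => none }

def sg0 : GState := newG initG 1 [1, 2, 3]
def sg1 : GState := newG sg0 2 [1, 2, 3]
def sg2 : GState :=
  sendG sg1 (1, 1, [1, 2, 3]) (initSubst 1 [1, 2, 3] 1) 1 1 (some (erase respA)) Subst.empty
def sg3 : GState :=
  sendG sg2 (2, 2, [1, 2, 3]) (initSubst 2 [1, 2, 3] 2) 2 1 none thB

theorem exec_attack : UExec (eraseProt exProt) [sg3, sg2, sg1, sg0, initG] := by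
  have e0 : UExec (eraseProt exProt) [sg0, initG] := ExecD.new 1 [1, 2, 3] ExecD.start
  have e1 : UExec (eraseProt exProt) [sg1, sg0, initG] := ExecD.new 2 [1, 2, 3] e0
  have e2 : UExec (eraseProt exProt) [sg2, sg1, sg0, initG] := by
    refine ExecD.send (1, 1, [1, 2, 3]) (.agent 0) e1 (.agentK _ _)
      (SendStep.succ (lp := none) ?_ ?_ rfl)
    · simp [sg1, sg0, newG, initG, Function.update_apply]
    · simp [eraseProt, exProt]
  refine ExecD.send (2, 2, [1, 2, 3])
    (Subst.empty.apply ((initSubst 1 [1, 2, 3] 1).apply (erase respA))) e2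
    (.mem ?_) (SendStep.succ (lp := some (erase pattB)) ?_ ?_ ?_)
  · exact Or.inl rfl
  · simp [sg2, sendG, sg1, sg0, newG, initG, Function.update_apply]
  · simp [eraseProt, exProt]
  · rfl

theorem not_usat : ¬ USat (eraseProt exProt) (eraseF phi2) := by
  intro h
  have := h _ exec_attack (fun _ => Subst.empty)
  simp only [phi2, Sem, eraseF, eraseST] at this
  have := this ((initSubst 1 [1, 2, 3] 1).union Subst.empty)
    ⟨sg2, by simp, (1, 1, [1, 2, 3]), by simp [sg2, sendG]⟩
    ((initSubst 2 [1, 2, 3] 2).union thB)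
    ⟨sg3, by simp, (2, 2, [1, 2, 3]), by simp [sg3, sendG]⟩
  have hc : ∀ (a : ℕ), ∀ g ∈ [sg3, sg2, sg1, sg0, initG], a ∉ g.corrupted := by
    intro a g hg
    simp only [List.mem_cons, List.not_mem_nil, or_false] at hg
    rcases hg with rfl | rfl | rfl | rfl | rfl <;>
      simp [sg3, sg2, sg1, sg0, sendG, newG, initG]
  rcases this with ((h | h) | h) | h
  · exact h ⟨1, rfl, hc 1⟩
  · exact h ⟨2, rfl, hc 2⟩
  · exact h rfl
  · exact h rfl

/-- the converse of the soundness theorem fails: there are a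
labeled protocol `Π` and a formula `φ ∈ L2^l` with `Π ⊨ φ` but `|Π| ⊭ |φ|`,
witnessed by the concrete protocol `exProt` and the concrete formula `phi2`. -/
theorem converse_fails :
    (IsL2 phi2 ∧ LSat exProt phi2 ∧ ¬ USat (eraseProt exProt) (eraseF phi2)) ∧
    ∃ (P : Protocol) (φ : Formula), IsL2 φ ∧ LSat P φ ∧
      ¬ USat (eraseProt P) (eraseF φ) := by
  exact ⟨⟨l2_phi2, lsat_phi2, not_usat⟩, exProt, phi2, l2_phi2, lsat_phi2, not_usat⟩

end Proto
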